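/- Let ξ₀ < L be real numbers and Ω = (ξ₀,L)×(0,1). Let 𝒜₃, 𝒜₄ : [0,1] → ℝ be continuous with 𝒜₃ > 0, and set 𝒜₊(η) = exp(−∫₀^η 𝒜₄(τ) dτ). Suppose 𝒰, 𝒱 are continuously differentiable on the closed rectangle [ξ₀,L]×[0,1], ℱ₂ is continuous, the equation ∂_η𝒱(ξ,η) − 𝒜₃(η)·∂_ξ𝒰(ξ,η) − 𝒜₄(η)·𝒱(ξ,η) = ℱ₂(ξ,η) holds in Ω, and the boundary conditions 𝒱(ξ,0) = 𝒱(ξ,1) = 0 hold for all ξ ∈ [ξ₀,L]. Then the solvability condition ∫₀¹∫_{ξ₀}^{L} 𝒜₊(η)·ℱ₂(ξ,η) dξ dη = ∫₀¹ 𝒜₃(η)·𝒜₊(η)·(𝒰(ξ₀,η) − 𝒰(L,η)) dη necessarily holds. -/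

import Mathlib

open MeasureTheory Set

/-- A primitive of a function continuous on `[a, b]` has the expected derivative inside. -/
theorem ContinuousOn.hasDerivAt_primitive_Ioo {f : ℝ → ℝ} {a b x : ℝ}
    (hf : ContinuousOn f (Icc a b)) (hx : x ∈ Ioo a b) :
    HasDerivAt (fun u => ∫ t in a..u, f t) (f x) x := by
  refine intervalIntegral.integral_hasDerivAt_right ?_ ?_ ?_
  · refine ContinuousOn.intervalIntegrable_of_Icc hx.1.le (hf.mono ?_)
    exact Icc_subset_Icc_right hx.2.le
  · exact (hf.mono Ioo_subset_Icc_self).stronglyMeasurableAtFilter isOpen_Ioo x hx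
  · exact hf.continuousAt (Icc_mem_nhds hx.1 hx.2)

theorem ContinuousOn.continuousOn_primitive_Icc {f : ℝ → ℝ} {a b : ℝ} (hab : a ≤ b)
    (hf : ContinuousOn f (Icc a b)) :
    ContinuousOn (fun u => ∫ t in a..u, f t) (Icc a b) := by
  rw [← uIcc_of_le hab] at hf ⊢
  exact intervalIntegral.continuousOn_primitive_interval (hf.integrableOn_compact isCompact_uIcc)

section Slices

variable {F : ℝ × ℝ → ℝ} {s t : Set ℝ} {x y : ℝ}

theorem ContinuousOn.slice_fst (hF : ContinuousOn F (s ×ˢ t)) (hy : y ∈ t) :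
    ContinuousOn (fun x => F (x, y)) s :=
  hF.comp (by fun_prop) fun _ hx => ⟨hx, hy⟩

theorem ContinuousOn.slice_snd (hF : ContinuousOn F (s ×ˢ t)) (hx : x ∈ s) :
    ContinuousOn (fun y => F (x, y)) t :=
  hF.comp (by fun_prop) fun _ hy => ⟨hx, hy⟩

theorem HasFDerivAt.hasDerivAt_slice_fst {F' : ℝ × ℝ →L[ℝ] ℝ} (hF : HasFDerivAt F F' (x, y)) :
    HasDerivAt (fun x => F (x, y)) (F' (1, 0)) x :=
  hF.comp_hasDerivAt x ((hasDerivAt_id x).prodMk (hasDerivAt_const x y))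

theorem HasFDerivAt.hasDerivAt_slice_snd {F' : ℝ × ℝ →L[ℝ] ℝ} (hF : HasFDerivAt F F' (x, y)) :
    HasDerivAt (fun y => F (x, y)) (F' (0, 1)) y :=
  hF.comp_hasDerivAt y ((hasDerivAt_const y x).prodMk (hasDerivAt_id y))

end Slices

section Rectangle

variable {F : ℝ × ℝ → ℝ} {a b c d : ℝ}

theorem ContDiffOn.continuousOn_fderivWithin_rectangle (hab : a < b) (hcd : c < d)
    (hF : ContDiffOn ℝ 1 F (Icc a b ×ˢ Icc c d)) (v : ℝ × ℝ) :
    ContinuousOn (fun z => fderivWithin ℝ F (Icc a b ×ˢ Icc c d) z v) (Icc a b ×ˢ Icc c d) :=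
  (hF.continuousOn_fderivWithin ((uniqueDiffOn_Icc hab).prod (uniqueDiffOn_Icc hcd))
    le_rfl).clm_apply continuousOn_const

theorem rectangle_mem_nhds {z : ℝ × ℝ} (hz : z ∈ Ioo a b ×ˢ Ioo c d) :
    Icc a b ×ˢ Icc c d ∈ nhds z :=
  prod_mem_nhds (Icc_mem_nhds hz.1.1 hz.1.2) (Icc_mem_nhds hz.2.1 hz.2.2)

theorem ContDiffOn.hasFDerivAt_rectangle (hF : ContDiffOn ℝ 1 F (Icc a b ×ˢ Icc c d))
    {z : ℝ × ℝ} (hz : z ∈ Ioo a b ×ˢ Ioo c d) :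
    HasFDerivAt F (fderivWithin ℝ F (Icc a b ×ˢ Icc c d) z) z := by
  have hmem := rectangle_mem_nhds hz
  exact ((hF.differentiableOn one_ne_zero z
    (mem_of_mem_nhds hmem)).hasFDerivWithinAt).hasFDerivAt hmem

theorem ContinuousOn.integrableOn_rectangle (hF : ContinuousOn F (Icc a b ×ˢ Icc c d))
    (hab : a ≤ b) (hcd : c ≤ d) : IntegrableOn F (uIoc a b ×ˢ uIoc c d) := by
  rw [uIoc_of_le hab, uIoc_of_le hcd]
  exact (hF.integrableOn_compact (isCompact_Icc.prod isCompact_Icc)).mono_set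
    (prod_mono Ioc_subset_Icc_self Ioc_subset_Icc_self)

theorem ContinuousOn.intervalIntegrable_integral_rectangle
    (hF : ContinuousOn F (Icc a b ×ˢ Icc c d)) (hab : a ≤ b) (hcd : c ≤ d) :
    IntervalIntegrable (fun y => ∫ x in a..b, F (x, y)) volume c d := by
  have h := hF.integrableOn_rectangle hab hcd
  rw [IntegrableOn, Measure.volume_eq_prod, ← Measure.prod_restrict] at h
  rw [intervalIntegrable_iff]
  simpa only [IntegrableOn, intervalIntegral.integral_of_le hab, uIoc_of_le hab] using h.integral_prod_right

/-- Integrating an `x`-derivative over a horizontal slice of the rectangle. -/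
theorem ContDiffOn.integral_fderivWithin_slice_fst (hab : a < b) (hcd : c < d)
    (hF : ContDiffOn ℝ 1 F (Icc a b ×ˢ Icc c d)) {y : ℝ} (hy : y ∈ Ioo c d) :
    ∫ x in a..b, fderivWithin ℝ F (Icc a b ×ˢ Icc c d) (x, y) (1, 0) = F (b, y) - F (a, y) :=
  intervalIntegral.integral_eq_sub_of_hasDerivAt_of_le hab.le
    (hF.continuousOn.slice_fst (Ioo_subset_Icc_self hy))
    (fun _ hx => (hF.hasFDerivAt_rectangle ⟨hx, hy⟩).hasDerivAt_slice_fst)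
    (((hF.continuousOn_fderivWithin_rectangle hab hcd (1, 0)).slice_fst
      (Ioo_subset_Icc_self hy)).intervalIntegrable_of_Icc hab.le)

end Rectangle


/-- Necessity of the solvability condition for the elliptic-hyperbolic composite
system: if `𝒱, 𝒰` are `C¹` on the closed rectangle `[ξ₀,L]×[0,1]`, the equation
`∂_η𝒱 − 𝒜₃(η)∂_ξ𝒰 − 𝒜₄(η)𝒱 = ℱ₂` holds in the open rectangle and `𝒱 = 0` on the
walls `η = 0` and `η = 1`, then with the integrating factor
`𝒜₊(η) = exp(−∫₀^η 𝒜₄)` one necessarily has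
`∫₀¹∫_{ξ₀}^L 𝒜₊ℱ₂ dξ dη = ∫₀¹ 𝒜₃𝒜₊(𝒰(ξ₀,·) − 𝒰(L,·)) dη`. -/
theorem solvability_condition_necessary
    (ξ₀ L : ℝ) (hξ₀L : ξ₀ < L)
    (A₃ A₄ : ℝ → ℝ)
    (hA₃c : ContinuousOn A₃ (Set.Icc 0 1))
    (hA₄c : ContinuousOn A₄ (Set.Icc 0 1))
    (hA₃pos : ∀ η ∈ Set.Icc (0:ℝ) 1, 0 < A₃ η)
    (Ap : ℝ → ℝ)
    (hAp : ∀ η : ℝ, Ap η = Real.exp (-∫ τ in (0:ℝ)..η, A₄ τ))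
    (U V F₂ : ℝ × ℝ → ℝ)
    (hU : ContDiffOn ℝ 1 U (Set.Icc ξ₀ L ×ˢ Set.Icc 0 1))
    (hV : ContDiffOn ℝ 1 V (Set.Icc ξ₀ L ×ˢ Set.Icc 0 1))
    (hF₂ : ContinuousOn F₂ (Set.Icc ξ₀ L ×ˢ Set.Icc 0 1))
    (hPDE : ∀ z ∈ Set.Ioo ξ₀ L ×ˢ Set.Ioo (0:ℝ) 1,
      fderiv ℝ V z (0, 1) - A₃ z.2 * fderiv ℝ U z (1, 0) - A₄ z.2 * V z = F₂ z)
    (hbc : ∀ ξ ∈ Set.Icc ξ₀ L, V (ξ, 0) = 0 ∧ V (ξ, 1) = 0) :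
    ∫ η in (0:ℝ)..1, ∫ ξ in ξ₀..L, Ap η * F₂ (ξ, η)
      = ∫ η in (0:ℝ)..1, A₃ η * Ap η * (U (ξ₀, η) - U (L, η)) := by
  set R : Set (ℝ × ℝ) := Icc ξ₀ L ×ˢ Icc 0 1
  have hsnd : MapsTo Prod.snd R (Icc (0 : ℝ) 1) := fun z hz => hz.2
  have hApc : ContinuousOn Ap (Icc 0 1) := by
    rw [funext hAp]
    exact (hA₄c.continuousOn_primitive_Icc zero_le_one).neg.rexp
  have hApd : ∀ η ∈ Ioo (0 : ℝ) 1, HasDerivAt Ap (-(A₄ η * Ap η)) η := by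
    intro η hη
    have h := (hA₄c.hasDerivAt_primitive_Ioo hη).neg.exp
    rw [funext hAp]
    exact h.congr_deriv (by rw [Pi.neg_apply, mul_neg, mul_comm])
  let G : ℝ × ℝ → ℝ := fun z =>
    -(A₄ z.2 * Ap z.2) * V z + Ap z.2 * fderivWithin ℝ V R z (0, 1)
  have hGc : ContinuousOn G R := by
    have hAp2 := hApc.comp continuousOn_snd hsnd
    have hA₄2 := hA₄c.comp continuousOn_snd hsnd
    exact ((hA₄2.mul hAp2).neg.mul hV.continuousOn).add
      (hAp2.mul (hV.continuousOn_fderivWithin_rectangle hξ₀L zero_lt_one (0, 1)))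
  have hGcol : ∀ ξ ∈ Ioo ξ₀ L, ∫ η in (0 : ℝ)..1, G (ξ, η) = 0 := by
    intro ξ hξ
    have hξ' := Ioo_subset_Icc_self hξ
    rw [intervalIntegral.integral_eq_sub_of_hasDerivAt_of_le zero_le_one
      (f := fun η => Ap η * V (ξ, η)) (hApc.mul (hV.continuousOn.slice_snd hξ'))
      (fun η hη => (hApd η hη).mul (hV.hasFDerivAt_rectangle ⟨hξ, hη⟩).hasDerivAt_slice_snd)
      ((hGc.slice_snd hξ').intervalIntegrable_of_Icc zero_le_one)]
    simp [hbc ξ hξ']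
  have hGzero : ∫ η in (0 : ℝ)..1, ∫ ξ in ξ₀..L, G (ξ, η) = 0 := by
    rw [← intervalIntegral_intervalIntegral_swap (F := fun ξ η => G (ξ, η))
      (hGc.integrableOn_rectangle hξ₀L.le zero_le_one),
      intervalIntegral.integral_congr_Ioo_of_le hξ₀L.le (g := fun _ => 0) hGcol,
      intervalIntegral.integral_zero]
  have hrow : EqOn (fun η => ∫ ξ in ξ₀..L, Ap η * F₂ (ξ, η))
      (fun η => (∫ ξ in ξ₀..L, G (ξ, η)) + A₃ η * Ap η * (U (ξ₀, η) - U (L, η)))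
      (Ioo 0 1) := by
    intro η hη
    have hη' := Ioo_subset_Icc_self hη
    have hpde : EqOn (fun ξ => Ap η * F₂ (ξ, η))
        (fun ξ => G (ξ, η) - A₃ η * Ap η * fderivWithin ℝ U R (ξ, η) (1, 0)) (Ioo ξ₀ L) := by
      intro ξ hξ
      have hmem : R ∈ nhds (ξ, η) := rectangle_mem_nhds ⟨hξ, hη⟩
      simp only [G, ← hPDE (ξ, η) ⟨hξ, hη⟩, fderivWithin_of_mem_nhds hmem]
      ring
    have hUint := ((hU.continuousOn_fderivWithin_rectangle hξ₀L zero_lt_one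
      (1, 0)).slice_fst hη').intervalIntegrable_of_Icc (μ := volume) hξ₀L.le
    simp only
    rw [intervalIntegral.integral_congr_Ioo_of_le hξ₀L.le hpde,
      intervalIntegral.integral_sub ((hGc.slice_fst hη').intervalIntegrable_of_Icc hξ₀L.le)
        (hUint.const_mul _),
      intervalIntegral.integral_const_mul,
      hU.integral_fderivWithin_slice_fst hξ₀L zero_lt_one hη]
    ring
  have hflux : ContinuousOn (fun η => A₃ η * Ap η * (U (ξ₀, η) - U (L, η))) (Icc 0 1) :=
    (hA₃c.mul hApc).mul ((hU.continuousOn.slice_snd (left_mem_Icc.2 hξ₀L.le)).sub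
      (hU.continuousOn.slice_snd (right_mem_Icc.2 hξ₀L.le)))
  rw [intervalIntegral.integral_congr_Ioo_of_le zero_le_one hrow,
    intervalIntegral.integral_add
      (hGc.intervalIntegrable_integral_rectangle hξ₀L.le zero_le_one)
      (hflux.intervalIntegrable_of_Icc zero_le_one), hGzero, zero_add]
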